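/- Let k be an algebraically closed field of characteristic p > 0, (H, ω) a finite-dimensional symplectic k-vector space, and I ⊆ H an isotropic subspace, with H' = I^⊥/I the induced symplectic space. Let φ and ψ be symplectic zips on H, both compatible with I, with induced zips φ' and ψ' on H'. If there exists τ ∈ Sp(H, ω) with ψ = τ∘φ∘τ^{-1}, then there exists σ ∈ Sp(H', ω') with ψ' = σ∘φ'∘σ^{-1}. -/

import Mathlib

/-!
STATEMENT 14: (alg. closed `k`, char `p`) Let `φ` and `ψ` be symplectic zips on `H`, both
compatible with the isotropic subspace `I`, with induced zips `φ'` and `ψ'` on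
`H' = I^⊥/I`. If there exists `τ ∈ Sp(H, ω)` with `ψ = τ∘φ∘τ⁻¹`, then there exists
`σ ∈ Sp(H', ω')` with `ψ' = σ∘φ'∘σ⁻¹`.
-/


/-- The orthogonal complement `F^⊥ = {x ∈ H : ω x y = 0 for all y ∈ F}`. -/
def perp {k H : Type*} [Field k] [AddCommGroup H] [Module k H]
    (ω : H →ₗ[k] H →ₗ[k] k) (F : Submodule k H) : Submodule k H where
  carrier := {x | ∀ y ∈ F, ω x y = 0}
  add_mem' := by
    intro a b ha hb y hy
    simp only [map_add, LinearMap.add_apply, ha y hy, hb y hy, add_zero]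
  zero_mem' := by
    intro y hy
    simp
  smul_mem' := by
    intro c x hx y hy
    simp only [map_smul, LinearMap.smul_apply, hx y hy, smul_zero]

/-- A subspace is Lagrangian if it equals its own orthogonal complement. -/
def IsLagrangian {k H : Type*} [Field k] [AddCommGroup H] [Module k H]
    (ω : H →ₗ[k] H →ₗ[k] k) (F : Submodule k H) : Prop :=
  perp ω F = F

/-- Over a perfect field the Frobenius is surjective, so ranges of Frobenius-semilinear
maps are submodules. -/
instance frobeniusSurjective (k : Type*) [Field k] (p : ℕ) [Fact p.Prime] [CharP k p]
    [PerfectRing k p] : RingHomSurjective (frobenius k p) :=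
  ⟨surjective_frobenius k p⟩

open Polynomial in
theorem zip_root {k : Type*} [Field k] [IsAlgClosed k] (p : ℕ) (hp : 2 ≤ p) (a : ℕ → k)
    (h0 : a 0 ≠ 0) (m : ℕ) :
    ∃ c : ℕ → k, c m ≠ 0 ∧ c 0 = a 0 * (c m) ^ p ∧
      ∀ i, c (i + 1) = (c i) ^ p + a (i + 1) * (c m) ^ p := by
  let P : ℕ → k[X] := fun n => Nat.rec (C (a 0) * X ^ p)
    (fun i q => q ^ p + C (a (i + 1)) * X ^ p) n
  have P0 : P 0 = C (a 0) * X ^ p := rfl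
  have PS : ∀ i, P (i + 1) = P i ^ p + C (a (i + 1)) * X ^ p := fun i => rfl
  have hdeg : ∀ i, (P i).natDegree = p ^ (i + 1) := by
    intro i
    induction i with
    | zero => rw [P0, natDegree_C_mul_X_pow _ _ h0]; simp
    | succ i ih =>
      have h1 : (P i ^ p).natDegree = p ^ (i + 2) := by
        rw [natDegree_pow, ih]; ring
      rw [PS, natDegree_add_eq_left_of_natDegree_lt, h1]
      rw [h1]
      refine lt_of_le_of_lt (natDegree_C_mul_X_pow_le _ _) ?_
      calc p = p ^ 1 := (pow_one p).symm
        _ < p ^ (i + 2) := Nat.pow_lt_pow_right (by omega) (by omega)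
  have hdvd : ∀ i, X ^ 2 ∣ P i := by
    intro i
    have hX : (X : k[X]) ^ 2 ∣ X ^ p := pow_dvd_pow _ hp
    induction i with
    | zero => rw [P0]; exact hX.mul_left _
    | succ i ih =>
      rw [PS]
      exact dvd_add (ih.trans (dvd_pow_self _ (by omega))) (hX.mul_left _)
  obtain ⟨S, hS⟩ := hdvd m
  have hS0 : S ≠ 0 := by
    rintro rfl
    have := hdeg m
    rw [hS] at this
    have h2 : 0 < p ^ (m + 1) := Nat.pow_pos (by omega)
    simp only [mul_zero, natDegree_zero] at this
    omega
  have hQ : (X * S - 1 : k[X]).degree ≠ 0 := by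
    have h1 : (X * S - 1 : k[X]).natDegree ≠ 0 := by
      rw [show (1 : k[X]) = C 1 from rfl, natDegree_sub_C, natDegree_X_mul hS0]
      omega
    intro h
    exact h1 (natDegree_eq_of_degree_eq_some h)
  obtain ⟨t, ht⟩ := IsAlgClosed.exists_root _ hQ
  have ht' : t * S.eval t = 1 := by
    have : eval t (X * S - 1) = 0 := ht
    simp at this
    linear_combination this
  have htm : (P m).eval t = t := by
    rw [hS]; simp; linear_combination t * ht'
  have ht0 : t ≠ 0 := by rintro rfl; simp at ht'
  refine ⟨fun i => (P i).eval t, ?_, ?_, ?_⟩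
  · simpa only [htm] using ht0
  · simp only [htm]; rw [P0]; simp
  · intro i; simp only [htm]; rw [PS]; simp

theorem zip_fixmod {k : Type*} [Field k] [IsAlgClosed k] (p : ℕ) [Fact p.Prime] [CharP k p]
    {H : Type*} [AddCommGroup H] [Module k H] [FiniteDimensional k H]
    (f : H →ₛₗ[frobenius k p] H) (E W : Submodule k H) (hE : ∀ x ∈ E, f x ∈ E)
    (hinj : ∀ x, f x ∈ W → x ∈ W) (x : H) (hx : x ∈ E) (hxW : x ∉ W) :
    ∃ y ∈ E, y ∉ W ∧ f y - y ∈ W := by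
  classical
  have hp : 2 ≤ p := (Fact.out : p.Prime).two_le
  have hex : ∃ n, ∃ a : ℕ → k, f^[n] x - ∑ i ∈ Finset.range n, a i • f^[i] x ∈ W := by
    let S : ℕ →o Submodule k H :=
      ⟨fun n => Submodule.span k ((fun i => f^[i] x) '' (Finset.range n : Set ℕ)), by
        intro m n h
        apply Submodule.span_mono
        apply Set.image_mono
        simpa using Finset.range_subset_range.2 h⟩
    obtain ⟨n, hn⟩ := monotone_stabilizes_iff_noetherian.2 (inferInstance : IsNoetherian k H) S
    have h1 : f^[n] x ∈ S n := by
      rw [hn (n + 1) (by omega)]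
      exact Submodule.subset_span ⟨n, by simp, rfl⟩
    obtain ⟨a, ha⟩ := (Submodule.mem_span_image_finset_iff_exists_fun k).1 h1
    refine ⟨n, fun i => if h : i ∈ Finset.range n then a ⟨i, h⟩ else 0, ?_⟩
    rw [← ha, ← Finset.sum_coe_sort (Finset.range n)]
    simp only [Finset.coe_mem, dif_pos, sub_self]
    exact W.zero_mem
  have hmin := fun m (h : m < Nat.find hex) => Nat.find_min hex h
  obtain ⟨a, ha⟩ := Nat.find_spec hex
  rcases hn : Nat.find hex with _ | m
  · rw [hn] at ha; simp at ha; exact absurd ha hxW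
  rw [hn] at ha
  have hm := hmin m (by omega)
  push Not at hm
  have ha0 : a 0 ≠ 0 := by
    intro h0
    choose r hr using fun i => IsAlgClosed.exists_pow_nat_eq (a (i + 1)) (by omega : 0 < p)
    apply hm r
    apply hinj
    rw [map_sub, map_sum]
    rw [Finset.sum_range_succ', h0, zero_smul, add_zero] at ha
    convert ha using 2
    · rw [Function.iterate_succ_apply']
    · refine Finset.sum_congr rfl fun i _ => ?_
      rw [LinearMap.map_smulₛₗ, frobenius_def, hr, Function.iterate_succ_apply']
  obtain ⟨c, hc, hc0, hcS⟩ := zip_root p hp a ha0 m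
  have hEi : ∀ i, f^[i] x ∈ E := by
    intro i
    induction i with
    | zero => exact hx
    | succ i ih => rw [Function.iterate_succ_apply']; exact hE _ ih
  refine ⟨∑ i ∈ Finset.range (m + 1), c i • f^[i] x,
    Submodule.sum_mem _ fun i _ => E.smul_mem _ (hEi i), ?_, ?_⟩
  · intro h
    apply hm (fun i => - (c m)⁻¹ * c i)
    have := W.smul_mem (c m)⁻¹ h
    rw [Finset.sum_range_succ, smul_add, smul_smul, inv_mul_cancel₀ hc, one_smul,
      Finset.smul_sum] at this
    convert this using 1
    rw [add_comm, sub_eq_add_neg, ← Finset.sum_neg_distrib]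
    congr 1
    refine Finset.sum_congr rfl fun i _ => ?_
    rw [smul_smul, neg_mul, neg_smul, neg_neg]
  · have h := W.smul_mem (c m ^ p) ha
    convert h using 1
    rw [map_sum]
    have e1 : ∀ i, f (c i • f^[i] x) = c i ^ p • f^[i + 1] x := by
      intro i
      rw [LinearMap.map_smulₛₗ, frobenius_def, Function.iterate_succ_apply']
    simp only [e1]
    rw [Finset.sum_range_succ, Finset.sum_range_succ' (fun i => c i • f^[i] x),
      Finset.sum_range_succ' (fun i => a i • f^[i] x), hc0]
    simp only [hcS, add_smul, Finset.sum_add_distrib, smul_sub, smul_add, Finset.smul_sum,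
      smul_smul, mul_comm (c m ^ p)]
    abel

theorem zip_span {k : Type*} [Field k] [IsAlgClosed k] (p : ℕ) [Fact p.Prime] [CharP k p]
    {H : Type*} [AddCommGroup H] [Module k H] [FiniteDimensional k H]
    (f : H →ₛₗ[frobenius k p] H) (N P : Submodule k H) (hP : ∀ x ∈ P, f x ∈ P)
    (hNP : N ≤ P) (r : ℕ) (hN : ∀ x, x ∈ N ↔ f^[r] x = 0) (hNi : ∀ x, f x ∈ N → x ∈ N) :
    N ⊔ Submodule.span k {x | x ∈ P ∧ f x = x} = P := by
  have hp : 2 ≤ p := (Fact.out : p.Prime).two_le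
  have hNf : ∀ x ∈ N, f x ∈ N := by
    intro x hx
    rw [hN] at hx ⊢
    rw [← Function.iterate_succ_apply, Function.iterate_succ_apply', hx, map_zero]
  set S := Submodule.span k {x | x ∈ P ∧ f x = x} with hS
  have hSP : S ≤ P := Submodule.span_le.2 fun x hx => hx.1
  have hSs : ∀ x ∈ S, ∃ y ∈ S, f y = x := by
    intro x hx
    induction hx using Submodule.span_induction with
    | mem x h => exact ⟨x, Submodule.subset_span h, h.2⟩
    | zero => exact ⟨0, S.zero_mem, map_zero f⟩
    | add x y _ _ h1 h2 =>
      obtain ⟨u, hu, rfl⟩ := h1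
      obtain ⟨v, hv, rfl⟩ := h2
      exact ⟨u + v, S.add_mem hu hv, map_add _ _ _⟩
    | smul a x _ h =>
      obtain ⟨u, hu, rfl⟩ := h
      obtain ⟨b, hb⟩ := IsAlgClosed.exists_pow_nat_eq a (by omega : 0 < p)
      exact ⟨b • u, S.smul_mem _ hu, by rw [LinearMap.map_smulₛₗ, frobenius_def, hb]⟩
  have hSl : ∀ x ∈ S, ∀ c : k, ∃ y ∈ S, f y - y = c • x := by
    intro x hx
    induction hx using Submodule.span_induction with
    | mem x h =>
      intro c
      have hdeg : (Polynomial.X ^ p - Polynomial.X - Polynomial.C c : Polynomial k).degree ≠ 0 := by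
        have h1 : (Polynomial.X ^ p - Polynomial.X - Polynomial.C c : Polynomial k).natDegree
            = p := by
          rw [Polynomial.natDegree_sub_C, Polynomial.natDegree_sub_eq_left_of_natDegree_lt] <;>
            simp <;> omega
        intro h
        have h2 : (Polynomial.X ^ p - Polynomial.X - Polynomial.C c : Polynomial k).natDegree
            = 0 := Polynomial.natDegree_eq_of_degree_eq_some h
        omega
      obtain ⟨t, ht⟩ := IsAlgClosed.exists_root _ hdeg
      have ht' : t ^ p - t = c := by
        simp [Polynomial.IsRoot] at ht
        linear_combination ht
      refine ⟨t • x, S.smul_mem _ (Submodule.subset_span h), ?_⟩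
      rw [LinearMap.map_smulₛₗ, frobenius_def, h.2, ← sub_smul, ht']
    | zero => exact fun c => ⟨0, S.zero_mem, by simp⟩
    | add x y _ _ h1 h2 =>
      intro c
      obtain ⟨u, hu, h1⟩ := h1 c
      obtain ⟨v, hv, h2⟩ := h2 c
      exact ⟨u + v, S.add_mem hu hv, by rw [smul_add, ← h1, ← h2, map_add]; abel⟩
    | smul a x _ h =>
      intro c
      obtain ⟨u, hu, h⟩ := h (c * a)
      exact ⟨u, hu, by rw [h, smul_smul]⟩
  have hNl : ∀ x ∈ N, ∃ y ∈ N, f y - y = x := by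
    intro x hx
    have hi : ∀ i, f^[i] x ∈ N := by
      intro i
      induction i with
      | zero => exact hx
      | succ i ih => rw [Function.iterate_succ_apply']; exact hNf _ ih
    refine ⟨- ∑ i ∈ Finset.range r, f^[i] x, N.neg_mem (N.sum_mem fun i _ => hi i), ?_⟩
    have h1 := Finset.sum_range_sub (fun i => f^[i] x) r
    rw [(hN x).1 hx, Finset.sum_sub_distrib] at h1
    rw [map_neg, map_sum]
    simp only [Function.iterate_succ_apply', Function.iterate_zero, id] at h1
    rw [neg_sub_neg, ← neg_sub, h1]; simp
  refine le_antisymm (sup_le hNP hSP) ?_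
  by_contra hcon
  obtain ⟨x, hx, hxW⟩ := SetLike.not_le_iff_exists.1 hcon
  obtain ⟨y, hy, hyW, hfy⟩ := zip_fixmod p f P (N ⊔ S) hP (by
      intro x hx
      obtain ⟨n, hn, s, hs, h⟩ := Submodule.mem_sup.1 hx
      obtain ⟨s', hs', rfl⟩ := hSs s hs
      have : x - s' ∈ N := hNi _ (by rw [map_sub, ← h]; simpa using hn)
      have := Submodule.add_mem_sup this hs'
      simpa using this) x hx hxW
  obtain ⟨n, hn, s, hs, h⟩ := Submodule.mem_sup.1 hfy
  obtain ⟨n', hn', rfl⟩ := hNl n hn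
  obtain ⟨s', hs', h'⟩ := hSl s hs 1
  rw [one_smul] at h'
  subst h'
  apply hyW
  have hz : y - (n' + s') ∈ S := by
    refine Submodule.subset_span ⟨P.sub_mem hy (P.add_mem (hNP hn') (hSP hs')), ?_⟩
    rw [map_sub, map_add]
    have : f y = y + (f n' - n' + (f s' - s')) := by rw [h]; abel
    rw [this]; abel
  have : y = n' + (s' + (y - (n' + s'))) := by abel
  rw [this]
  exact Submodule.add_mem_sup hn' (S.add_mem hs' hz)

theorem zip_inj {k : Type*} [Field k] (p : ℕ) [Fact p.Prime] [CharP k p]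
    {H : Type*} [AddCommGroup H] [Module k H]
    (f : H →ₛₗ[frobenius k p] H) (x : H) (hx : x ∈ Submodule.span k {x | f x = x})
    (h0 : f x = 0) : x = 0 := by
  obtain ⟨b, hb, hspan, hli⟩ := exists_linearIndependent k {x | f x = x}
  rw [← hspan] at hx
  rw [← Subtype.range_coe (s := b)] at hx
  obtain ⟨c, rfl⟩ := (Finsupp.mem_span_range_iff_exists_finsupp).1 hx
  rw [Finsupp.sum, map_sum] at h0
  have h1 : ∑ i ∈ c.support, (c i) ^ p • (i : H) = 0 := by
    rw [← h0]
    refine Finset.sum_congr rfl fun i _ => ?_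
    rw [LinearMap.map_smulₛₗ, frobenius_def, hb i.2]
  have h2 := linearIndependent_iff'.1 hli _ _ h1
  rw [Finsupp.sum]
  refine Finset.sum_eq_zero fun i hi => ?_
  rw [eq_zero_of_pow_eq_zero (h2 i hi), zero_smul]

theorem zip_disjoint {k : Type*} [Field k] (p : ℕ) [Fact p.Prime] [CharP k p]
    {H : Type*} [AddCommGroup H] [Module k H]
    (f : H →ₛₗ[frobenius k p] H) (N : Submodule k H) (r : ℕ) (hN : ∀ x, x ∈ N ↔ f^[r] x = 0) :
    Disjoint N (Submodule.span k {x | f x = x}) := by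
  set S := Submodule.span k {x | f x = x} with hS
  have hSf : ∀ x ∈ S, f x ∈ S := by
    intro x hx
    induction hx using Submodule.span_induction with
    | mem x h => rw [show f x = x from h]; exact Submodule.subset_span h
    | zero => simp
    | add x y _ _ h1 h2 => rw [map_add]; exact S.add_mem h1 h2
    | smul a x _ h => rw [LinearMap.map_smulₛₗ]; exact S.smul_mem _ h
  rw [Submodule.disjoint_def]
  intro x hx hxS
  rw [hN] at hx
  clear hN
  induction r generalizing x with
  | zero => exact hx
  | succ r ih =>
    rw [Function.iterate_succ_apply] at hx
    exact zip_inj p f x hxS (ih _ hx (hSf _ hxS))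

theorem zip_family {k : Type*} [Field k] [IsAlgClosed k] (p : ℕ) [Fact p.Prime] [CharP k p]
    {H : Type*} [AddCommGroup H] [Module k H] [FiniteDimensional k H]
    (f : H →ₛₗ[frobenius k p] H) (N P : Submodule k H) (hP : ∀ x ∈ P, f x ∈ P)
    (hNP : N ≤ P) (r : ℕ) (hN : ∀ x, x ∈ N ↔ f^[r] x = 0) (hNi : ∀ x, f x ∈ N → x ∈ N)
    (n m : ℕ) (hn : Module.finrank k N + n = Module.finrank k P)
    (hm : Module.finrank k P + m = Module.finrank k H) :
    ∃ v : Fin n ⊕ Fin m → H, LinearIndependent k v ∧ (∀ i, f (v i) = v i) ∧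
      Submodule.span k (Set.range v) = Submodule.span k {x | f x = x} ∧
      N ⊔ Submodule.span k (Set.range (v ∘ Sum.inl)) = P := by
  have hdis := zip_disjoint p f N r hN
  have hsP := zip_span p f N P hP hNP r hN hNi
  have hsT := zip_span p f N ⊤ (by simp) le_top r hN hNi
  simp only [Submodule.mem_top, true_and] at hsT
  obtain ⟨b0, hb0, hspan0, hli0⟩ := exists_linearIndependent k {x | x ∈ P ∧ f x = x}
  have hb0' : b0 ⊆ {x | f x = x} := fun x hx => (hb0 hx).2
  obtain ⟨b, hb, hbb, hbs, hli⟩ := exists_linearIndepOn_id_extension hli0 hb0'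
  have hspan : Submodule.span k b = Submodule.span k {x | f x = x} :=
    le_antisymm (Submodule.span_mono hb) (Submodule.span_le.2 hbs)
  have : Finite b := hli.finite
  have hbf : b.Finite := this
  have hb0f : b0.Finite := hbf.subset hbb
  have := hb0f.to_subtype
  have hc0 : b0.ncard = n := by
    have h1 := Submodule.finrank_sup_add_finrank_inf_eq N (Submodule.span k b0)
    have h2 : N ⊓ Submodule.span k b0 = ⊥ :=
      (hdis.mono_right (Submodule.span_mono hb0')).eq_bot
    rw [h2, hspan0, hsP, ← hspan0, finrank_bot] at h1
    have := Fintype.ofFinite b0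
    have h3 := finrank_span_set_eq_card hli0
    rw [Set.ncard_eq_toFinset_card']
    omega
  have hc : b.ncard = n + m := by
    have h1 := Submodule.finrank_sup_add_finrank_inf_eq N (Submodule.span k b)
    have h2 : N ⊓ Submodule.span k b = ⊥ :=
      (hdis.mono_right (Submodule.span_mono hb)).eq_bot
    rw [h2, hspan, hsT, ← hspan, finrank_bot, finrank_top] at h1
    have := Fintype.ofFinite b
    have h3 := finrank_span_set_eq_card hli
    rw [Set.ncard_eq_toFinset_card']
    omega
  have hcd : (b \ b0).ncard = m := by
    rw [Set.ncard_sdiff hbb hb0f]; omega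
  have := (hbf.subset (Set.sdiff_subset (t := b0))).to_subtype
  classical
  let e0 : Fin n ≃ b0 := (Finite.equivFinOfCardEq hc0).symm
  let e1 : Fin m ≃ (b \ b0 : Set H) := (Finite.equivFinOfCardEq hcd).symm
  let e : Fin n ⊕ Fin m ≃ b := (Equiv.sumCongr e0 e1).trans (Equiv.Set.sumDiffSubset hbb)
  have hr : Set.range (fun i => (e i : H)) = b := by
    have := e.surjective.range_comp (fun i : b => (i : H))
    rw [Subtype.range_coe] at this
    exact this
  refine ⟨fun i => (e i : H), ?_, fun i => hb (e i).2, ?_, ?_⟩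
  · exact LinearIndependent.comp hli e e.injective
  · rw [hr, hspan]
  · have : Set.range ((fun i => (e i : H)) ∘ Sum.inl) = b0 := by
      have := e0.surjective.range_comp (fun i : b0 => (i : H))
      rw [Subtype.range_coe] at this
      rw [← this]
      rfl
    rw [this, hspan0, hsP]

theorem zip_aut {k : Type*} [Field k] [IsAlgClosed k] (p : ℕ) [Fact p.Prime] [CharP k p]
    {H : Type*} [AddCommGroup H] [Module k H] [FiniteDimensional k H]
    (f : H →ₛₗ[frobenius k p] H) (N P Q : Submodule k H) (hP : ∀ x ∈ P, f x ∈ P)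
    (hQ : ∀ x ∈ Q, f x ∈ Q)
    (hNP : N ≤ P) (hNQ : N ≤ Q) (r : ℕ) (hN : ∀ x, x ∈ N ↔ f^[r] x = 0)
    (hNi : ∀ x, f x ∈ N → x ∈ N) (hPQ : Module.finrank k P = Module.finrank k Q) :
    ∃ a : H ≃ₗ[k] H, (∀ x ∈ N, a x = x) ∧
      (∀ x, a x - x ∈ Submodule.span k {x | f x = x}) ∧ (∀ x, f (a x) = a (f x)) ∧
      ∀ x ∈ Q, a x ∈ P := by
  have hNf : ∀ x ∈ N, f x ∈ N := by
    intro x hx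
    rw [hN] at hx ⊢
    rw [← Function.iterate_succ_apply, Function.iterate_succ_apply', hx, map_zero]
  have hdis := zip_disjoint p f N r hN
  have hsT := zip_span p f N ⊤ (by simp) le_top r hN hNi
  simp only [Submodule.mem_top, true_and] at hsT
  obtain ⟨n, hn⟩ := Nat.exists_eq_add_of_le (Submodule.finrank_mono hNP)
  obtain ⟨m, hm⟩ := Nat.exists_eq_add_of_le (Submodule.finrank_le P)
  obtain ⟨v, hv, hvf, hvs, hvP⟩ := zip_family p f N P hP hNP r hN hNi n m hn.symm hm.symm
  obtain ⟨w, hw, hwf, hws, hwQ⟩ := zip_family p f N Q hQ hNQ r hN hNi n m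
    (by omega) (by omega)
  set E := Submodule.span k {x | f x = x} with hE
  have hcomp : IsCompl E N := ⟨hdis.symm, codisjoint_iff.2 (by rw [sup_comm]; exact hsT)⟩
  let g : E ≃ₗ[k] E := (LinearEquiv.ofEq _ _ hws).symm ≪≫ₗ
    ((Module.Basis.span hw).equiv (Module.Basis.span hv) (Equiv.refl _)) ≪≫ₗ
    (LinearEquiv.ofEq _ _ hvs)
  have hg : ∀ i (h : w i ∈ E), (g ⟨w i, h⟩ : H) = v i := by
    intro i h
    have h1 : (LinearEquiv.ofEq _ _ hws).symm ⟨w i, h⟩ = Module.Basis.span hw i := by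
      apply Subtype.ext
      rw [Module.Basis.span_apply]
      rfl
    simp only [g, LinearEquiv.trans_apply, h1, Module.Basis.equiv_apply]
    simp [Module.Basis.span_apply]
  let d := Submodule.prodEquivOfIsCompl E N hcomp
  let a : H ≃ₗ[k] H := d.symm ≪≫ₗ (g.prodCongr (LinearEquiv.refl k N)) ≪≫ₗ d
  have ha : ∀ (e : E) (y : N), a (e + y) = g e + y := by
    intro e y
    have h1 : d.symm (e + y) = (e, y) := by
      rw [LinearEquiv.symm_apply_eq]; simp [d]
    simp only [a, LinearEquiv.trans_apply, h1]
    simp [d]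
  have haN : ∀ x ∈ N, a x = x := by
    intro x hx
    simpa using ha 0 ⟨x, hx⟩
  have haE : ∀ x (hx : x ∈ E), a x = g ⟨x, hx⟩ := by
    intro x hx
    simpa using ha ⟨x, hx⟩ 0
  have hwE : ∀ i, w i ∈ E := fun i => Submodule.subset_span (hwf i)
  have haw : ∀ i, a (w i) = v i := fun i => by rw [haE _ (hwE i), hg]
  refine ⟨a, haN, ?_, ?_, ?_⟩
  · intro x
    obtain ⟨y, hy, e, he, rfl⟩ := Submodule.mem_sup.1 (hsT ▸ Submodule.mem_top : x ∈ N ⊔ E)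
    rw [map_add, haN y hy, haE e he]
    have := E.sub_mem (g ⟨e, he⟩).2 he
    convert this using 1
    abel
  · intro x
    obtain ⟨y, hy, e, he, rfl⟩ := Submodule.mem_sup.1 (hsT ▸ Submodule.mem_top : x ∈ N ⊔ E)
    simp only [map_add, haN y hy, haN _ (hNf y hy)]
    congr 1
    rw [← hws] at he
    induction he using Submodule.span_induction with
    | mem x h => obtain ⟨i, rfl⟩ := h; rw [haw, hvf, hwf, haw]
    | zero => simp
    | add x y _ _ h1 h2 => simp only [map_add, h1, h2]
    | smul c x _ h => simp only [map_smul, LinearMap.map_smulₛₗ, h]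
  · intro x hx
    rw [← hwQ] at hx
    obtain ⟨y, hy, e, he, rfl⟩ := Submodule.mem_sup.1 hx
    rw [map_add, haN y hy, ← hvP]
    refine Submodule.add_mem_sup hy ?_
    clear hx
    induction he using Submodule.span_induction with
    | mem x h => obtain ⟨i, rfl⟩ := h; exact Submodule.subset_span ⟨i, (haw _).symm⟩
    | zero => simp
    | add x y _ _ h1 h2 => rw [map_add]; exact Submodule.add_mem _ h1 h2
    | smul c x _ h => rw [map_smul]; exact Submodule.smul_mem _ _ h

theorem zip_symp {k : Type*} [Field k] [IsAlgClosed k] (p : ℕ) [Fact p.Prime] [CharP k p]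
    {H : Type*} [AddCommGroup H] [Module k H] [FiniteDimensional k H]
    (ω : H →ₗ[k] H →ₗ[k] k)
    (halt : ∀ x, ω x x = 0)
    (hnd : ∀ x, (∀ y, ω x y = 0) → x = 0)
    (f : H →ₛₗ[frobenius k p] H)
    (hker : IsLagrangian ω (LinearMap.ker f))
    (hrange : IsLagrangian ω (LinearMap.range f))
    (P Q : Submodule k H) (hP : ∀ x ∈ P, f x ∈ P)
    (hQ : ∀ x ∈ Q, f x ∈ Q) (hPi : ∀ x, f x ∈ P → x ∈ P) (hQi : ∀ x, f x ∈ Q → x ∈ Q)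
    (hPQ : Module.finrank k P = Module.finrank k Q) :
    ∃ G : H ≃ₗ[k] H, (∀ x y, ω (G x) (G y) = ω x y) ∧ (∀ x, f (G x) = G (f x)) ∧
      ∀ x ∈ Q, G x ∈ P := by
  have hanti : ∀ x y, ω x y = - ω y x := by
    intro x y
    have h := halt (x + y)
    simp only [map_add, LinearMap.add_apply, halt, zero_add, add_zero] at h
    linear_combination h
  -- generalized kernel
  let K : ℕ →o Submodule k H :=
    { toFun := fun n =>
        { carrier := {x | f^[n] x = 0}
          zero_mem' := by
            induction n with
            | zero => rfl
            | succ n ih => simpa using ih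
          add_mem' := by
            intro x y hx hy
            have : ∀ n x y, f^[n] (x + y) = f^[n] x + f^[n] y := by
              intro n
              induction n with
              | zero => intro x y; rfl
              | succ n ih =>
                intro x y
                simp only [Function.iterate_succ_apply, map_add, ih]
            simp only [Set.mem_ofPred_eq] at *
            rw [this, hx, hy, add_zero]
          smul_mem' := by
            intro c x hx
            have : ∀ n x (c : k), f^[n] (c • x) = c ^ (p ^ n) • f^[n] x := by
              intro n
              induction n with
              | zero => intro x c; simp
              | succ n ih =>
                intro x c
                rw [Function.iterate_succ_apply, LinearMap.map_smulₛₗ, frobenius_def, ih,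
                  ← pow_mul, ← pow_succ', Function.iterate_succ_apply]
            simp only [Set.mem_ofPred_eq] at *
            rw [this, hx, smul_zero] }
      monotone' := by
        refine monotone_nat_of_le_succ fun n x hx => ?_
        have hx' : f^[n] x = 0 := hx
        show f^[n + 1] x = 0
        rw [Function.iterate_succ_apply', hx', map_zero] }
  obtain ⟨r, hr⟩ := monotone_stabilizes_iff_noetherian.2 (inferInstance : IsNoetherian k H) K
  set N := K r with hNdef
  have hN : ∀ x, x ∈ N ↔ f^[r] x = 0 := fun x => Iff.rfl
  have hNi : ∀ x, f x ∈ N → x ∈ N := by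
    intro x hx
    rw [hr (r + 1) (by omega)]
    show f^[r + 1] x = 0
    rw [Function.iterate_succ_apply]
    exact hx
  have hle : ∀ R : Submodule k H, (∀ x, f x ∈ R → x ∈ R) → N ≤ R := by
    intro R hR x hx
    have : ∀ n x, f^[n] x = 0 → x ∈ R := by
      intro n
      induction n with
      | zero => intro x hx; rw [show x = 0 from hx]; exact R.zero_mem
      | succ n ih => intro x hx; exact hR x (ih _ hx)
    exact this r x hx
  have hkN : ∀ x, f x = 0 → x ∈ N := fun x hx => hNi x (by rw [hx]; exact N.zero_mem)
  obtain ⟨a, haN, haE, haf, haQ⟩ :=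
    zip_aut p f N P Q hP hQ (hle P hPi) (hle Q hQi) r hN hNi hPQ
  have hrr : ∀ x y, ω (f x) (f y) = 0 := by
    intro x y
    have : f x ∈ perp ω (LinearMap.range f) := by
      rw [show perp ω (LinearMap.range f) = _ from hrange]; exact ⟨x, rfl⟩
    exact this _ ⟨y, rfl⟩
  have hER : Submodule.span k {x | f x = x} ≤ LinearMap.range f :=
    Submodule.span_le.2 fun x hx => ⟨x, hx⟩
  have hE : ∀ x ∈ Submodule.span k {x | f x = x}, ∀ y, ω x (f y) = 0 := by
    intro x hx y
    obtain ⟨u, rfl⟩ := hER hx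
    exact hrr u y
  have haE' : ∀ x, a.symm x - x ∈ Submodule.span k {x | f x = x} := by
    intro x
    have := haE (a.symm x)
    rw [LinearEquiv.apply_symm_apply] at this
    simpa using Submodule.neg_mem _ this
  have hinj : Function.Injective ω := by
    rw [injective_iff_map_eq_zero]
    intro x hx
    exact hnd x (fun y => by rw [hx]; rfl)
  let we : H ≃ₗ[k] (H →ₗ[k] k) :=
    LinearMap.linearEquivOfInjective ω hinj (Subspace.dual_finrank_eq (K := k) (V := H)).symm
  let c : H →ₗ[k] H := we.symm.toLinearMap ∘ₗ (ω.compl₂ (a.symm.toLinearMap - LinearMap.id))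
  have hc : ∀ v h, ω (c v) h = ω v (a.symm h - h) := by
    intro v h
    have : we (c v) = ω.compl₂ (a.symm.toLinearMap - LinearMap.id) v := by simp [c]
    have h2 := LinearMap.congr_fun this h
    simpa [we] using h2
  have hcN : ∀ v, f (c v) = 0 := by
    intro v
    have : c v ∈ perp ω (LinearMap.ker f) := by
      intro y hy
      have h1 : a.symm y = y := by
        rw [LinearEquiv.symm_apply_eq, haN y (hkN y hy)]
      rw [hc, h1, sub_self, map_zero]
    rw [show perp ω (LinearMap.ker f) = _ from hker] at this
    exact this
  have hcN' : ∀ v, ∀ y ∈ N, ω (c v) y = 0 := by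
    intro v y hy
    have h1 : a.symm y = y := by
      rw [LinearEquiv.symm_apply_eq, haN y hy]
    rw [hc, h1, sub_self, map_zero]
  have hsymp : ∀ u v, ω (a u + c u) (a v + c v) = ω u v := by
    intro u v
    have h1 : ω (c u) (a v) = ω u v - ω u (a v) := by
      rw [hc, LinearEquiv.symm_apply_apply, map_sub]
    have h2 : ω (a u) (c v) = ω u v - ω (a u) v := by
      rw [hanti, hc, LinearEquiv.symm_apply_apply, map_sub, hanti v u, hanti v (a u)]; ring
    have h3 : ω (c u) (c v) = 0 := hcN' u _ (hkN _ (hcN v))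
    have h4 : ω (a u - u) (a v - v) = 0 := by
      obtain ⟨y, hy⟩ := hER (haE v)
      rw [← hy]
      exact hE _ (haE u) y
    simp only [map_add, map_sub, LinearMap.add_apply, LinearMap.sub_apply] at h4 ⊢
    rw [h1, h2, h3]
    linear_combination h4
  let G0 : H →ₗ[k] H := a.toLinearMap + c
  have hG0 : ∀ x, G0 x = a x + c x := fun x => rfl
  have hG0i : Function.Injective G0 := by
    rw [injective_iff_map_eq_zero]
    intro x hx
    refine hnd x fun y => ?_
    rw [← hsymp, ← hG0, hx]; simp
  refine ⟨LinearEquiv.ofInjectiveEndo G0 hG0i, ?_, ?_, ?_⟩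
  · intro x y
    exact hsymp x y
  · intro x
    show f (a x + c x) = a (f x) + c (f x)
    rw [map_add, hcN, haf]
    congr 1
    symm
    refine hnd _ fun y => ?_
    rw [hc, hanti, hE _ (haE' y), neg_zero]
  · intro x hx
    show a x + c x ∈ P
    exact P.add_mem (haQ x hx) (hle P hPi (hkN _ (hcN x)))

theorem zip_perp_perp {k : Type*} [Field k]
    {H : Type*} [AddCommGroup H] [Module k H] [FiniteDimensional k H]
    (ω : H →ₗ[k] H →ₗ[k] k)
    (halt : ∀ x, ω x x = 0)
    (hnd : ∀ x, (∀ y, ω x y = 0) → x = 0)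
    (I : Submodule k H) (x : H) (hx : ∀ y ∈ perp ω I, ω y x = 0) : x ∈ I := by
  by_contra hxI
  obtain ⟨l, hl, hlI⟩ := Submodule.exists_le_ker_of_notMem hxI
  have hinj : Function.Injective ω := by
    rw [injective_iff_map_eq_zero]
    intro x hx
    exact hnd x (fun y => by rw [hx]; rfl)
  let we : H ≃ₗ[k] (H →ₗ[k] k) :=
    LinearMap.linearEquivOfInjective ω hinj (Subspace.dual_finrank_eq (K := k) (V := H)).symm
  obtain ⟨y, rfl⟩ := we.surjective l
  exact hl (hx y fun z hz => hlI hz)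

theorem induced_conjugate_of_zip_conjugate
    {k : Type*} [Field k] (p : ℕ) [Fact p.Prime] [CharP k p] [IsAlgClosed k]
    {H : Type*} [AddCommGroup H] [Module k H] [FiniteDimensional k H]
    (ω : H →ₗ[k] H →ₗ[k] k)
    (halt : ∀ x, ω x x = 0)
    (hnd : ∀ x, (∀ y, ω x y = 0) → x = 0)
    (I : Submodule k H) (hiso : I ≤ perp ω I)
    -- the induced form `ω'` on `H' = I^⊥ / I`:
    (ω' : (perp ω I ⧸ I.comap (perp ω I).subtype) →ₗ[k]
        (perp ω I ⧸ I.comap (perp ω I).subtype) →ₗ[k] k)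
    (hω' : ∀ x y : perp ω I,
        ω' (Submodule.Quotient.mk x) (Submodule.Quotient.mk y) = ω (x : H) (y : H))
    -- `φ` is a symplectic zip on `H` compatible with `I`:
    (φ : H →ₛₗ[frobenius k p] H)
    (hφker : IsLagrangian ω (LinearMap.ker φ))
    (hφrange : IsLagrangian ω (LinearMap.range φ))
    (hφI : ∀ x ∈ I, φ x = 0)
    (hφP : ∀ x ∈ perp ω I, φ x ∈ perp ω I)
    (hφinj : ∀ x : H, φ x ∈ perp ω I → x ∈ perp ω I)
    (hφsurj : ∀ y : H, ∃ x : H, y - φ x ∈ perp ω I)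
    -- `ψ` is a symplectic zip on `H` compatible with `I`:
    (ψ : H →ₛₗ[frobenius k p] H)
    (hψker : IsLagrangian ω (LinearMap.ker ψ))
    (hψrange : IsLagrangian ω (LinearMap.range ψ))
    (hψI : ∀ x ∈ I, ψ x = 0)
    (hψP : ∀ x ∈ perp ω I, ψ x ∈ perp ω I)
    (hψinj : ∀ x : H, ψ x ∈ perp ω I → x ∈ perp ω I)
    (hψsurj : ∀ y : H, ∃ x : H, y - ψ x ∈ perp ω I)
    -- the induced zips `φ'` and `ψ'` on `H' = I^⊥ / I`:
    (φ' : (perp ω I ⧸ I.comap (perp ω I).subtype) →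
        (perp ω I ⧸ I.comap (perp ω I).subtype))
    (hφ' : ∀ (x : perp ω I) (hx : φ (x : H) ∈ perp ω I),
        φ' (Submodule.Quotient.mk x) =
          Submodule.Quotient.mk (⟨φ (x : H), hx⟩ : perp ω I))
    (ψ' : (perp ω I ⧸ I.comap (perp ω I).subtype) →
        (perp ω I ⧸ I.comap (perp ω I).subtype))
    (hψ' : ∀ (x : perp ω I) (hx : ψ (x : H) ∈ perp ω I),
        ψ' (Submodule.Quotient.mk x) =
          Submodule.Quotient.mk (⟨ψ (x : H), hx⟩ : perp ω I)) :
    (∃ τ : H ≃ₗ[k] H, (∀ x y, ω (τ x) (τ y) = ω x y) ∧ ∀ x : H, ψ x = τ (φ (τ.symm x))) →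
    ∃ σ : (perp ω I ⧸ I.comap (perp ω I).subtype) ≃ₗ[k]
        (perp ω I ⧸ I.comap (perp ω I).subtype),
      (∀ z w, ω' (σ z) (σ w) = ω' z w) ∧ ∀ z, ψ' z = σ (φ' (σ.symm z)) := by
  rintro ⟨τ, hτ, hτψ⟩
  have hτ' : ∀ x, ψ (τ x) = τ (φ x) := fun x => by rw [hτψ, LinearEquiv.symm_apply_apply]
  obtain ⟨G, hG, hGψ, hGQ⟩ := zip_symp p ω halt hnd ψ hψker hψrange (perp ω I)
    ((perp ω I).map τ.toLinearMap) hψP (by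
      rintro _ ⟨x, hx, rfl⟩
      exact ⟨φ x, hφP x hx, (hτ' x).symm⟩) hψinj (by
      intro x hx
      obtain ⟨y, hy, hxy⟩ := hx
      refine ⟨τ.symm x, hφinj _ ?_, by simp⟩
      have h1 := hτψ x
      rw [← hxy] at h1
      rw [← τ.injective h1]
      exact hy) (LinearEquiv.finrank_map_eq τ _).symm
  let T : H ≃ₗ[k] H := τ ≪≫ₗ G
  have hT : ∀ x y, ω (T x) (T y) = ω x y := fun x y => by
    simp only [T, LinearEquiv.trans_apply, hG, hτ]
  have hTf : ∀ x, ψ (T x) = T (φ x) := fun x => by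
    simp only [T, LinearEquiv.trans_apply, hGψ, hτ']
  have hTP : (perp ω I).map T.toLinearMap = perp ω I := by
    refine Submodule.eq_of_le_of_finrank_eq ?_ (LinearEquiv.finrank_map_eq T _)
    rintro _ ⟨x, hx, rfl⟩
    exact hGQ _ ⟨x, hx, rfl⟩
  have hTI : I.map T.toLinearMap = I := by
    refine Submodule.eq_of_le_of_finrank_eq ?_ (LinearEquiv.finrank_map_eq T _)
    rintro _ ⟨x, hx, rfl⟩
    refine zip_perp_perp ω halt hnd I _ fun y hy => ?_
    rw [← hTP] at hy
    obtain ⟨z, hz, rfl⟩ := hy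
    exact (hT z x).trans (hz x hx)
  let TP : perp ω I ≃ₗ[k] perp ω I := T.ofSubmodules _ _ hTP
  have hTPc : ∀ x : perp ω I, (TP x : H) = T x := fun x => rfl
  have hq : (I.comap (perp ω I).subtype).map TP.toLinearMap = I.comap (perp ω I).subtype := by
    refine Submodule.eq_of_le_of_finrank_eq ?_ (LinearEquiv.finrank_map_eq TP _)
    rintro _ ⟨x, hx, rfl⟩
    show T x ∈ I
    exact hTI.le ⟨x, hx, rfl⟩
  let σ := Submodule.Quotient.equiv _ _ TP hq
  have hσ : ∀ x, σ (Submodule.Quotient.mk x) = Submodule.Quotient.mk (TP x) := fun x => rfl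
  refine ⟨σ, ?_, ?_⟩
  · intro z w
    obtain ⟨x, rfl⟩ := Submodule.Quotient.mk_surjective _ z
    obtain ⟨y, rfl⟩ := Submodule.Quotient.mk_surjective _ w
    rw [hσ, hσ, hω', hω', hTPc, hTPc, hT]
  · intro z
    obtain ⟨w, rfl⟩ := σ.surjective z
    obtain ⟨x, rfl⟩ := Submodule.Quotient.mk_surjective _ w
    rw [LinearEquiv.symm_apply_apply, hφ' x (hφP _ x.2), hσ, hσ, hψ' _ (hψP _ (TP x).2)]
    congr 1
    exact Subtype.ext (hTf x)
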